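/- There exists a distance d₂ on the Heisenberg group ℍ that is biLipschitz equivalent to d_b (there is C ≥ 1 with C⁻¹·d_b ≤ d₂ ≤ C·d_b) and such that no blow-up of d₂ is self-similar nor left-invariant: whenever λ_j → 0 and q_j ∈ ℍ are sequences such that the functions (p₁,p₂) ↦ (1/λ_j)·d₂(q_j·δ_{λ_j}(p₁), q_j·δ_{λ_j}(p₂)) converge pointwise to a function ρ, there is no λ > 1 with ρ(δ_λ(p), δ_λ(q)) = λ·ρ(p,q) for all p, q, and it is not the case that ρ(g·p, g·q) = ρ(p,q) for all g, p, q ∈ ℍ. -/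

import Mathlib

open scoped ENNReal

namespace Heis

/-- The underlying set of the Heisenberg group: `ℝ³`. -/
abbrev H : Type := ℝ × ℝ × ℝ

/-- Heisenberg group multiplication. -/
noncomputable def Hmul (p q : H) : H :=
  (p.1 + q.1, p.2.1 + q.2.1, p.2.2 + q.2.2 + (p.1 * q.2.1 - p.2.1 * q.1) / 2)

/-- Heisenberg group inverse. -/
def Hinv (p : H) : H := (-p.1, -p.2.1, -p.2.2)

/-- The box norm `‖p‖ = max {|x|, |y|, √|z|}`. -/
noncomputable def boxNorm (p : H) : ℝ :=
  max |p.1| (max |p.2.1| (Real.sqrt |p.2.2|))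

/-- The box distance `d_b(p,q) = ‖p⁻¹·q‖`. -/
noncomputable def dbox (p q : H) : ℝ := boxNorm (Hmul (Hinv p) q)

/-- The dilations `δ_λ(x,y,z) = (λx, λy, λ²z)`. -/
noncomputable def dil (lam : ℝ) (p : H) : H := (lam * p.1, lam * p.2.1, lam ^ 2 * p.2.2)

/-- `d` is a distance (metric) on `X`. -/
def IsDistance {X : Type*} (d : X → X → ℝ) : Prop :=
  (∀ x y, d x y = d y x) ∧ (∀ x, d x x = 0) ∧
  (∀ x y, d x y = 0 → x = y) ∧ (∀ x y z, d x z ≤ d x y + d y z)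

/-- The open ball of the distance function `d`. -/
def ballOf {X : Type*} (d : X → X → ℝ) (x : X) (r : ℝ) : Set X := {y | d x y < r}

/-- The (extended) diameter of a set with respect to a distance function `d`. -/
noncomputable def ediamOf {X : Type*} (d : X → X → ℝ) (E : Set X) : ℝ≥0∞ :=
  ⨆ (x ∈ E) (y ∈ E), ENNReal.ofReal (d x y)

/-- The Hausdorff `Q`-measure of `A` with respect to the distance function `d`:
`H^Q_d(A) = lim_{ε→0} inf { Σᵢ (diam Eᵢ)^Q : A ⊆ ⋃ᵢ Eᵢ, diam Eᵢ ≤ ε }`. -/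
noncomputable def hausdorffOf {X : Type*} (d : X → X → ℝ) (Q : ℝ) (A : Set X) : ℝ≥0∞ :=
  ⨆ (ε : ℝ≥0∞) (_ : 0 < ε),
    ⨅ (E : ℕ → Set X) (_ : A ⊆ ⋃ n, E n) (_ : ∀ n, ediamOf d (E n) ≤ ε),
      ∑' n, ediamOf d (E n) ^ Q

/-- `(X, d)` is Ahlfors `Q`-regular: there is `C ≥ 1` with
`C⁻¹ r^Q ≤ H^Q_d(B_d(x,r)) ≤ C r^Q` for all `x` and `0 < r < diam X`. -/
def AhlforsRegularOf {X : Type*} (d : X → X → ℝ) (Q : ℝ) : Prop :=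
  ∃ C : ℝ, 1 ≤ C ∧ ∀ (x : X) (r : ℝ), 0 < r → ENNReal.ofReal r < ediamOf d Set.univ →
    ENNReal.ofReal (C⁻¹ * r ^ Q) ≤ hausdorffOf d Q (ballOf d x r) ∧
    hausdorffOf d Q (ballOf d x r) ≤ ENNReal.ofReal (C * r ^ Q)

/-- The distances `d` and `ρ` are biLipschitz equivalent on the set `A`. -/
def BiLipOn {X : Type*} (d ρ : X → X → ℝ) (A : Set X) : Prop :=
  ∃ L : ℝ, 1 ≤ L ∧ ∀ x ∈ A, ∀ y ∈ A, L⁻¹ * ρ x y ≤ d x y ∧ d x y ≤ L * ρ x y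

/-- The indices whose `2`-adic valuation is odd: a set of naturals no shift limit of which is
periodic. -/
def OddVal (n : ℕ) : Prop := Odd (padicValNat 2 n)

lemma padicValNat_two_pow_mul_odd (a o : ℕ) (ho : Odd o) : padicValNat 2 (2 ^ a * o) = a := by
  have h0 : o ≠ 0 := by rintro rfl; simp at ho
  rw [padicValNat.mul (by positivity) h0, padicValNat.prime_pow,
    padicValNat.eq_zero_of_not_dvd ho.not_two_dvd_nat, add_zero]

lemma exists_not_oddVal_oddVal_add {m : ℕ} (hm : 0 < m) :
    ∃ K, ∀ N, ∃ n, N ≤ n ∧ n ≤ N + K ∧ ¬ OddVal n ∧ OddVal (n + m) := by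
  obtain ⟨a, o, ho, rfl⟩ := Nat.exists_eq_two_pow_mul_odd hm.ne'
  have bound (M r N : ℕ) (hM : 0 < M) :
      N ≤ M * (N / M + 1) + r ∧ M * (N / M + 1) + r ≤ N + (M + r) := by
    have h1 := Nat.div_add_mod N M
    have h2 := Nat.mod_lt N hM
    rw [mul_add]
    omega
  rcases Nat.even_or_odd a with ha | ha
  · refine ⟨2 ^ (a + 2) + 2 ^ a * o, fun N => ?_⟩
    set c := N / 2 ^ (a + 2) + 1
    obtain ⟨h1, h2⟩ := bound (2 ^ (a + 2)) (2 ^ a * o) N (by positivity)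
    refine ⟨_, h1, h2, ?_, ?_⟩
    · have e : 2 ^ (a + 2) * c + 2 ^ a * o = 2 ^ a * (2 * (2 * c) + o) := by ring
      rw [OddVal, e, padicValNat_two_pow_mul_odd _ _ ((even_two_mul _).add_odd ho)]
      exact Nat.not_odd_iff_even.2 ha
    · have e : 2 ^ (a + 2) * c + 2 ^ a * o + 2 ^ a * o = 2 ^ (a + 1) * (2 * c + o) := by ring
      rw [OddVal, e, padicValNat_two_pow_mul_odd _ _ ((even_two_mul _).add_odd ho)]
      exact ha.add_one
  · refine ⟨2 ^ (a + 2) + 2 ^ (a + 1), fun N => ?_⟩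
    set c := N / 2 ^ (a + 2) + 1
    obtain ⟨h1, h2⟩ := bound (2 ^ (a + 2)) (2 ^ (a + 1)) N (by positivity)
    refine ⟨_, h1, h2, ?_, ?_⟩
    · have e : 2 ^ (a + 2) * c + 2 ^ (a + 1) = 2 ^ (a + 1) * (2 * c + 1) := by ring
      rw [OddVal, e, padicValNat_two_pow_mul_odd _ _ (odd_two_mul_add_one c)]
      exact Nat.not_odd_iff_even.2 ha.add_one
    · have e : 2 ^ (a + 2) * c + 2 ^ (a + 1) + 2 ^ a * o
          = 2 ^ a * (2 * (2 * c + 1) + o) := by ring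
      rw [OddVal, e, padicValNat_two_pow_mul_odd _ _ ((even_two_mul _).add_odd ho)]
      exact ha

lemma exists_oddVal_near (N : ℕ) : ∃ n, N ≤ n ∧ n ≤ N + 6 ∧ OddVal n := by
  refine ⟨4 * (N / 4 + 1) + 2, by omega, by omega, ?_⟩
  have e : 4 * (N / 4 + 1) + 2 = 2 ^ 1 * (2 * (N / 4 + 1) + 1) := by ring
  rw [OddVal, e, padicValNat_two_pow_mul_odd _ _ (odd_two_mul_add_one _)]
  exact odd_one

/-- Some multiple of a non-integer real stays away from the integers. -/
lemma exists_nat_mul_far_from_int {l : ℝ} (hl : ∀ m : ℤ, l ≠ m) :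
    ∃ k : ℕ, ∀ m : ℤ, 1 / 4 ≤ |(m : ℝ) - k * l| := by
  set d := l - round l with hd
  have hd0 : 0 < |d| := abs_pos.2 (sub_ne_zero.2 (hl _))
  have hd1 : |d| ≤ 1 / 2 := abs_sub_round l
  have hex : ∃ k : ℕ, 1 / 4 ≤ k * |d| := by
    obtain ⟨k, hk⟩ := exists_nat_gt ((1 / 4) / |d|)
    exact ⟨k, ((div_lt_iff₀ hd0).1 hk).le⟩
  classical
  let k := Nat.find hex
  have hk1 : 1 / 4 ≤ k * |d| := Nat.find_spec hex
  have hk0 : k ≠ 0 := by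
    intro h
    rw [h] at hk1
    norm_num at hk1
  have hk2 : (k : ℝ) * |d| ≤ 3 / 4 := by
    have := Nat.find_min hex (Nat.sub_one_lt hk0)
    push Not at this
    rw [Nat.cast_sub (Nat.one_le_iff_ne_zero.2 hk0)] at this
    change ((k : ℝ) - (1 : ℕ)) * |d| < 1 / 4 at this
    push_cast at this
    linarith
  refine ⟨k, fun m => ?_⟩
  have e : (m : ℝ) - k * l = ((m - k * round l : ℤ) : ℝ) - k * d := by
    push_cast
    rw [hd]
    ring
  rw [e]
  have hkd : |(k : ℝ) * d| = k * |d| := by rw [abs_mul, Nat.abs_cast]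
  rw [← hkd] at hk1 hk2
  generalize (k : ℝ) * d = t at hk1 hk2
  generalize m - k * round l = i
  by_cases hi : i = 0
  · subst hi
    simpa using hk1
  · have : (1 : ℝ) ≤ |(i : ℝ)| := by exact_mod_cast Int.one_le_abs hi
    have := abs_sub_abs_le_abs_sub (i : ℝ) t
    linarith

lemma exists_oddVal_shift_far {l : ℝ} (hl : 0 < l) :
    ∃ k K : ℕ, ∀ N, ∃ n, N ≤ n ∧ n ≤ N + K ∧ OddVal n ∧
      ∀ m, OddVal m → 1 / 4 ≤ |(n : ℝ) - k * l - m| := by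
  by_cases h : ∃ m : ℤ, l = m
  · obtain ⟨m, rfl⟩ := h
    have hm : 0 < m := by exact_mod_cast hl
    lift m to ℕ using hm.le
    obtain ⟨K, hK⟩ := exists_not_oddVal_oddVal_add (m := m) (by exact_mod_cast hm)
    refine ⟨1, K + m, fun N => ?_⟩
    obtain ⟨n, h1, h2, h3, h4⟩ := hK N
    refine ⟨n + m, by omega, by omega, h4, fun i hi => ?_⟩
    have hne : (n : ℤ) - i ≠ 0 := by
      intro h0
      exact h3 ((by omega : i = n) ▸ hi)
    have : (1 : ℝ) ≤ |((n - i : ℤ) : ℝ)| := by exact_mod_cast Int.one_le_abs hne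
    push_cast at this ⊢
    rw [show (n : ℝ) + m - 1 * m - i = n - i by ring]
    linarith
  · push Not at h
    obtain ⟨k, hk⟩ := exists_nat_mul_far_from_int h
    refine ⟨k, 6, fun N => ?_⟩
    obtain ⟨n, h1, h2, h3⟩ := exists_oddVal_near N
    refine ⟨n, h1, h2, h3, fun m _ => ?_⟩
    have := hk (n - m)
    push_cast at this
    rwa [show (n : ℝ) - k * l - m = n - m - k * l by ring]

/-- The length scales at which the distance is perturbed. -/
noncomputable def scale (n : ℕ) : ℝ := (1 / 256) ^ n

lemma scale_pos (n : ℕ) : 0 < scale n := by unfold scale; positivity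

/-- `t` is far (on a logarithmic scale) from all the perturbed length scales. -/
def FarFromScales (t : ℝ) : Prop := ∀ m, OddVal m → 4 * scale m ≤ t ∨ 4 * t ≤ scale m

lemma exists_scale_far {lam : ℝ} (hlam : 1 < lam) :
    ∃ k K : ℕ, ∀ N, ∃ n, N ≤ n ∧ n ≤ N + K ∧ OddVal n ∧ FarFromScales (lam ^ k * scale n) := by
  have hl0 : 0 < Real.logb 256 lam := Real.logb_pos (by norm_num) hlam
  obtain ⟨k, K, h⟩ := exists_oddVal_shift_far hl0
  refine ⟨k, K, fun N => ?_⟩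
  obtain ⟨n, h1, h2, h3, h4⟩ := h N
  refine ⟨n, h1, h2, h3, fun m hm => ?_⟩
  have h5 := h4 m hm
  have hs (i : ℕ) : scale i = (256 : ℝ) ^ (-(i : ℝ)) := by
    rw [scale, Real.rpow_neg (by norm_num), Real.rpow_natCast, one_div, inv_pow]
  have h4' : (4 : ℝ) = 256 ^ (1 / 4 : ℝ) := by
    rw [show (256 : ℝ) = 4 ^ (4 : ℝ) by norm_num, ← Real.rpow_mul (by norm_num)]
    norm_num
  have hk : lam ^ k = (256 : ℝ) ^ (k * Real.logb 256 lam) := by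
    rw [mul_comm, Real.rpow_mul (by norm_num), Real.rpow_logb (by norm_num) (by norm_num)
      (by linarith), Real.rpow_natCast]
  have h256 : (0 : ℝ) < 256 := by norm_num
  rw [hk, hs, hs, h4', ← Real.rpow_add h256, ← Real.rpow_add h256, ← Real.rpow_add h256,
    Real.rpow_le_rpow_left_iff (by norm_num), Real.rpow_le_rpow_left_iff (by norm_num)]
  rcases le_abs.1 h5 with h6 | h6
  · right; linarith
  · left; linarith

lemma scale_far_of_ne {m n : ℕ} (h : m ≠ n) : 4 * scale m ≤ scale n ∨ 4 * scale n ≤ scale m := by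
  have key {a b : ℕ} (hab : a < b) : 4 * scale b ≤ scale a := by
    have h1 : scale b ≤ scale (a + 1) :=
      pow_le_pow_of_le_one (by norm_num) (by norm_num) hab
    have h2 : scale (a + 1) = scale a * (1 / 256) := pow_succ _ _
    have := scale_pos a
    linarith
  rcases lt_or_gt_of_ne h with h | h
  · exact Or.inr (key h)
  · exact Or.inl (key h)

lemma boxNorm_nonneg (p : H) : 0 ≤ boxNorm p := (abs_nonneg _).trans (le_max_left _ _)

lemma abs_fst_le_boxNorm (p : H) : |p.1| ≤ boxNorm p := le_max_left _ _

lemma abs_snd_le_boxNorm (p : H) : |p.2.1| ≤ boxNorm p :=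
  (le_max_left _ _).trans (le_max_right _ _)

lemma abs_trd_le_boxNorm_sq (p : H) : |p.2.2| ≤ boxNorm p ^ 2 :=
  (Real.sqrt_le_left (boxNorm_nonneg p)).1 ((le_max_right _ _).trans (le_max_right _ _))

lemma boxNorm_le {p : H} {r : ℝ} (hr : 0 ≤ r) (h1 : |p.1| ≤ r) (h2 : |p.2.1| ≤ r)
    (h3 : |p.2.2| ≤ r ^ 2) : boxNorm p ≤ r :=
  max_le h1 (max_le h2 ((Real.sqrt_le_left hr).2 h3))

lemma boxNorm_Hmul_le (p q : H) : boxNorm (Hmul p q) ≤ boxNorm p + boxNorm q := by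
  have hp := boxNorm_nonneg p
  have hq := boxNorm_nonneg q
  have p1 := abs_fst_le_boxNorm p
  have p2 := abs_snd_le_boxNorm p
  have p3 := abs_trd_le_boxNorm_sq p
  have q1 := abs_fst_le_boxNorm q
  have q2 := abs_snd_le_boxNorm q
  have q3 := abs_trd_le_boxNorm_sq q
  refine boxNorm_le (by positivity) ?_ ?_ ?_
  · exact (abs_add_le _ _).trans (add_le_add p1 q1)
  · exact (abs_add_le _ _).trans (add_le_add p2 q2)
  · have a1 : |p.1 * q.2.1| ≤ boxNorm p * boxNorm q := by
      rw [abs_mul]; exact mul_le_mul p1 q2 (abs_nonneg _) hp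
    have a2 : |p.2.1 * q.1| ≤ boxNorm p * boxNorm q := by
      rw [abs_mul]; exact mul_le_mul p2 q1 (abs_nonneg _) hp
    have := mul_nonneg hp hq
    simp only [Hmul]
    rw [abs_le] at *
    constructor <;> nlinarith

lemma boxNorm_Hinv (p : H) : boxNorm (Hinv p) = boxNorm p := by
  simp [boxNorm, Hinv]

lemma boxNorm_dil {lam : ℝ} (h : 0 < lam) (p : H) : boxNorm (dil lam p) = lam * boxNorm p := by
  simp only [boxNorm, dil, abs_mul, abs_of_pos h, abs_of_pos (pow_pos h 2)]
  rw [Real.sqrt_mul (by positivity), Real.sqrt_sq h.le, mul_max_of_nonneg _ _ h.le,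
    mul_max_of_nonneg _ _ h.le]

lemma dbox_nonneg (p q : H) : 0 ≤ dbox p q := boxNorm_nonneg _

lemma dbox_comm (p q : H) : dbox p q = dbox q p := by
  rw [dbox, ← boxNorm_Hinv, dbox]
  congr 1
  ext <;> simp only [Hmul, Hinv] <;> ring

lemma dbox_self (p : H) : dbox p p = 0 := by
  have : Hmul (Hinv p) p = (0, 0, 0) := by ext <;> simp only [Hmul, Hinv] <;> ring
  rw [dbox, this]
  simp [boxNorm]

lemma eq_of_dbox_eq_zero {p q : H} (h : dbox p q = 0) : p = q := by
  rw [dbox] at h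
  have h1 := abs_fst_le_boxNorm (Hmul (Hinv p) q)
  have h2 := abs_snd_le_boxNorm (Hmul (Hinv p) q)
  have h3 := abs_trd_le_boxNorm_sq (Hmul (Hinv p) q)
  rw [h] at h1 h2 h3
  norm_num at h1 h2 h3
  simp only [Hmul, Hinv] at h1 h2 h3
  have e1 : q.1 = p.1 := by linarith
  have e2 : q.2.1 = p.2.1 := by linarith
  rw [e1, e2] at h3
  ext
  · exact e1.symm
  · exact e2.symm
  · linarith

lemma dbox_triangle (p q r : H) : dbox p r ≤ dbox p q + dbox q r := by
  have : Hmul (Hinv p) r = Hmul (Hmul (Hinv p) q) (Hmul (Hinv q) r) := by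
    ext <;> simp only [Hmul, Hinv] <;> ring
  rw [dbox, this]
  exact boxNorm_Hmul_le _ _

lemma dbox_Hmul_left (g p q : H) : dbox (Hmul g p) (Hmul g q) = dbox p q := by
  rw [dbox, dbox]
  congr 1
  ext <;> simp only [Hmul, Hinv] <;> ring

lemma dbox_dil {lam : ℝ} (h : 0 < lam) (p q : H) :
    dbox (dil lam p) (dil lam q) = lam * dbox p q := by
  rw [dbox, dbox, ← boxNorm_dil h]
  congr 1
  ext <;> simp only [Hmul, Hinv, dil] <;> ring

/-- Translation along the centre. -/
def vert (t : ℝ) (p : H) : H := (p.1, p.2.1, p.2.2 + t)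

lemma Hmul_vert (g p : H) (t : ℝ) : Hmul g (vert t p) = vert t (Hmul g p) := by
  ext <;> simp only [Hmul, vert]; ring

lemma dil_vert (lam : ℝ) (p : H) (t : ℝ) : dil lam (vert t p) = vert (lam ^ 2 * t) (dil lam p) := by
  ext <;> simp only [dil, vert]; ring

lemma dbox_vert {t : ℝ} (ht : 0 ≤ t) (p : H) : dbox p (vert t p) = Real.sqrt t := by
  have : Hmul (Hinv p) (vert t p) = (0, 0, t) := by
    ext <;> simp only [Hmul, Hinv, vert] <;> ring
  rw [dbox, this]
  simp [boxNorm, abs_of_nonneg ht, Real.sqrt_nonneg]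

lemma continuous_dbox : Continuous fun x : H × H => dbox x.1 x.2 := by
  unfold dbox boxNorm Hmul Hinv
  fun_prop

/-- The distance from a real number to the integers. -/
noncomputable def tent (x : ℝ) : ℝ := min (Int.fract x) (1 - Int.fract x)

lemma tent_nonneg (x : ℝ) : 0 ≤ tent x :=
  le_min (Int.fract_nonneg x) (by linarith [Int.fract_lt_one x])

lemma tent_le (x : ℝ) : tent x ≤ 1 / 2 := by
  rcases min_le_iff.1 (le_refl (tent x)) with h | h <;> (rw [tent] at *; grind)

lemma abs_tent_sub_le {x y : ℝ} (h : ⌊x⌋ = ⌊y⌋) : |tent x - tent y| ≤ |x - y| := by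
  have hx := Int.self_sub_floor x
  have hy := Int.self_sub_floor y
  rw [h] at hx
  have e : x - y = Int.fract x - Int.fract y := by linarith
  rw [e]
  unfold tent
  grind

lemma tent_le_of_floor_ne {x y : ℝ} (h : ⌊x⌋ ≠ ⌊y⌋) : tent x ≤ |x - y| := by
  have hx := Int.self_sub_floor x
  rcases lt_or_gt_of_ne h with h | h
  · have h1 : (⌊x⌋ : ℝ) + 1 ≤ ⌊y⌋ := by exact_mod_cast h
    have h2 := Int.floor_le y
    refine (min_le_right _ _).trans (le_abs.2 (Or.inr ?_))
    linarith
  · have h1 : y < ⌊x⌋ := Int.floor_lt.1 h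
    refine (min_le_left _ _).trans (le_abs.2 (Or.inl ?_))
    linarith

/-- A phase that moves at unit speed along the centre and at bounded speed along the horizontal
directions inside each slab `⌊x⌋ = k`. -/
noncomputable def phase (p : H) : ℝ := p.2.2 + p.1 * p.2.1 / 2 - ⌊p.1⌋ * p.2.1

/-- A bounded Lipschitz function on the Heisenberg group oscillating along the centre. -/
noncomputable def wave (p : H) : ℝ := tent p.1 * Real.cos (phase p)

lemma abs_wave_le_tent (p : H) : |wave p| ≤ tent p.1 := by
  rw [wave, abs_mul, abs_of_nonneg (tent_nonneg _)]
  exact mul_le_of_le_one_right (tent_nonneg _) (Real.abs_cos_le_one _)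

lemma abs_cos_sub_cos_le (a b : ℝ) : |Real.cos a - Real.cos b| ≤ |a - b| := by
  simpa [Real.dist_eq] using Real.lipschitzWith_cos.dist_le_mul a b

lemma abs_wave_sub_le_one (p q : H) : |wave p - wave q| ≤ 1 := by
  have := abs_sub (wave p) (wave q)
  linarith [abs_wave_le_tent p, abs_wave_le_tent q, tent_le p.1, tent_le q.1]

lemma abs_wave_sub_le (p q : H) : |wave p - wave q| ≤ 3 * dbox p q := by
  have hD := dbox_nonneg p q
  have h1 : |-p.1 + q.1| ≤ dbox p q := abs_fst_le_boxNorm (Hmul (Hinv p) q)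
  have h2 : |-p.2.1 + q.2.1| ≤ dbox p q := abs_snd_le_boxNorm (Hmul (Hinv p) q)
  have h3 : |-p.2.2 + q.2.2 + (-p.1 * q.2.1 - -p.2.1 * q.1) / 2| ≤ dbox p q ^ 2 :=
    abs_trd_le_boxNorm_sq (Hmul (Hinv p) q)
  set D := dbox p q
  rcases le_total 1 D with hD1 | hD1
  · linarith [abs_wave_sub_le_one p q]
  have h1' : |p.1 - q.1| ≤ D := by rwa [← abs_neg, show -(p.1 - q.1) = -p.1 + q.1 by ring]
  by_cases hf : ⌊p.1⌋ = ⌊q.1⌋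
  · have hph : |phase p - phase q| ≤ 5 / 2 * D := by
      have f0 := Int.floor_le p.1
      have f1 := (Int.lt_floor_add_one p.1).le
      have e : phase q - phase p = (-p.2.2 + q.2.2 + (-p.1 * q.2.1 - -p.2.1 * q.1) / 2)
          + (-p.1 + q.1) * (-p.2.1 + q.2.1) / 2 + (p.1 - ⌊p.1⌋) * (-p.2.1 + q.2.1) := by
        simp only [phase, ← hf]
        ring
      have b1 : |(-p.1 + q.1) * (-p.2.1 + q.2.1)| ≤ D * D := by
        rw [abs_mul]; exact mul_le_mul h1 h2 (abs_nonneg _) hD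
      have b2 : |(p.1 - ⌊p.1⌋) * (-p.2.1 + q.2.1)| ≤ 1 * D := by
        rw [abs_mul]
        refine mul_le_mul ?_ h2 (abs_nonneg _) zero_le_one
        rw [abs_le]; constructor <;> linarith
      have hDD : D * D ≤ D := mul_le_of_le_one_right hD hD1
      rw [abs_sub_comm, e]
      rw [sq] at h3
      rw [abs_le] at h3 b1 b2 ⊢
      constructor <;> linarith
    have e : wave p - wave q = (tent p.1 - tent q.1) * Real.cos (phase p)
        + tent q.1 * (Real.cos (phase p) - Real.cos (phase q)) := by
      simp only [wave]; ring
    have t1 : |(tent p.1 - tent q.1) * Real.cos (phase p)| ≤ D * 1 := by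
      rw [abs_mul]
      exact mul_le_mul ((abs_tent_sub_le hf).trans h1') (Real.abs_cos_le_one _) (abs_nonneg _) hD
    have t2 : |tent q.1 * (Real.cos (phase p) - Real.cos (phase q))| ≤ 1 / 2 * (5 / 2 * D) := by
      rw [abs_mul, abs_of_nonneg (tent_nonneg _)]
      exact mul_le_mul (tent_le _) ((abs_cos_sub_cos_le _ _).trans hph) (abs_nonneg _)
        (by norm_num)
    rw [e]
    have := abs_add_le ((tent p.1 - tent q.1) * Real.cos (phase p))
      (tent q.1 * (Real.cos (phase p) - Real.cos (phase q)))
    linarith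
  · have a1 := tent_le_of_floor_ne hf
    have a2 := tent_le_of_floor_ne (Ne.symm hf)
    rw [abs_sub_comm] at a2
    have := abs_sub (wave p) (wave q)
    linarith [abs_wave_le_tent p, abs_wave_le_tent q]

lemma wave_vert (p : H) (t : ℝ) : wave (vert t p) = tent p.1 * Real.cos (phase p + t) := by
  simp only [wave, vert, phase]
  congr 2
  ring

lemma abs_wave_sub_wave_vert_le {t : ℝ} (ht : 0 ≤ t) (p : H) :
    |wave p - wave (vert t p)| ≤ t / 2 := by
  rw [wave_vert, wave, ← mul_sub, abs_mul, abs_of_nonneg (tent_nonneg _)]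
  have h := abs_cos_sub_cos_le (phase p) (phase p + t)
  rw [show phase p - (phase p + t) = -t by ring, abs_neg, abs_of_nonneg ht] at h
  calc _ ≤ 1 / 2 * t := mul_le_mul (tent_le _) h (abs_nonneg _) (by norm_num)
    _ = t / 2 := by ring

/-- The function `wave` rescaled to the length scale `scale n`. -/
noncomputable def waveAt (n : ℕ) (p : H) : ℝ := scale n * wave (dil (scale n)⁻¹ p)

lemma abs_waveAt_sub_le (n : ℕ) (p q : H) : |waveAt n p - waveAt n q| ≤ 3 * dbox p q := by
  have hs := scale_pos n
  rw [waveAt, waveAt, ← mul_sub, abs_mul, abs_of_pos hs]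
  have := abs_wave_sub_le (dil (scale n)⁻¹ p) (dil (scale n)⁻¹ q)
  rw [dbox_dil (inv_pos.2 hs)] at this
  calc _ ≤ scale n * (3 * ((scale n)⁻¹ * dbox p q)) := mul_le_mul_of_nonneg_left this hs.le
    _ = 3 * dbox p q := by field_simp

/-- The oscillation semi-distance, measuring `waveAt` at all perturbed scales. -/
noncomputable def osc (p q : H) : ℝ := ⨆ n : {n // OddVal n}, |waveAt n p - waveAt n q|

lemma osc_nonneg (p q : H) : 0 ≤ osc p q := Real.iSup_nonneg fun _ => abs_nonneg _

lemma osc_le (p q : H) : osc p q ≤ 3 * dbox p q :=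
  Real.iSup_le (fun n => abs_waveAt_sub_le n p q) (by have := dbox_nonneg p q; positivity)

lemma abs_waveAt_sub_le_osc {n : ℕ} (hn : OddVal n) (p q : H) :
    |waveAt n p - waveAt n q| ≤ osc p q :=
  le_ciSup (f := fun n : {n // OddVal n} => |waveAt n p - waveAt n q|)
    ⟨3 * dbox p q, by rintro _ ⟨n, rfl⟩; exact abs_waveAt_sub_le n p q⟩ ⟨n, hn⟩

lemma osc_comm (p q : H) : osc p q = osc q p := by
  unfold osc
  simp_rw [abs_sub_comm]

lemma osc_triangle (p q r : H) : osc p r ≤ osc p q + osc q r :=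
  Real.iSup_le (fun n => (abs_sub_le _ (waveAt n q) _).trans
    (add_le_add (abs_waveAt_sub_le_osc n.2 p q) (abs_waveAt_sub_le_osc n.2 q r)))
    (add_nonneg (osc_nonneg p q) (osc_nonneg q r))

lemma osc_vert_le {t : ℝ} (ht : 0 < t) (p : H) (h : ∀ m, OddVal m →
    (4 * scale m ≤ t ∨ 4 * t ≤ scale m) ∨ tent ((scale m)⁻¹ * p.1) = 0) :
    osc p (vert (Real.pi * t ^ 2) p) ≤ t / 2 := by
  refine Real.iSup_le (fun ⟨m, hm⟩ => ?_) (by positivity)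
  have hs := scale_pos m
  have hpi := Real.pi_pos
  simp only [waveAt]
  rw [← mul_sub, abs_mul, abs_of_pos hs, dil_vert]
  set p' := dil (scale m)⁻¹ p with hp'
  rcases h m hm with (h | h) | h
  · calc _ ≤ scale m * 1 := mul_le_mul_of_nonneg_left (abs_wave_sub_le_one _ _) hs.le
      _ ≤ t / 2 := by linarith
  · calc _ ≤ scale m * ((scale m)⁻¹ ^ 2 * (Real.pi * t ^ 2) / 2) :=
          mul_le_mul_of_nonneg_left (abs_wave_sub_wave_vert_le (by positivity) _) hs.le
      _ = Real.pi * t ^ 2 / (2 * scale m) := by field_simp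
      _ ≤ t / 2 := by
          rw [div_le_iff₀ (by positivity)]
          nlinarith [Real.pi_le_four, mul_le_mul_of_nonneg_left h ht.le]
  · have h' : tent p'.1 = 0 := h
    rw [wave_vert, wave, h']
    simp only [zero_mul, sub_zero, abs_zero, mul_zero]
    positivity

lemma scale_le_osc_vert {n : ℕ} (hn : OddVal n) {p : H} (h1 : tent ((scale n)⁻¹ * p.1) = 1 / 2)
    (h2 : Real.cos (phase (dil (scale n)⁻¹ p)) = 1) :
    scale n ≤ osc p (vert (Real.pi * scale n ^ 2) p) := by
  refine le_trans (le_of_eq ?_) (abs_waveAt_sub_le_osc hn _ _)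
  have hs := scale_pos n
  simp only [waveAt]
  rw [← mul_sub, abs_mul, abs_of_pos hs, dil_vert]
  have e : (scale n)⁻¹ ^ 2 * (Real.pi * scale n ^ 2) = Real.pi := by field_simp
  have h1' : tent (dil (scale n)⁻¹ p).1 = 1 / 2 := h1
  rw [e, wave_vert, wave, h1', Real.cos_add_pi, h2]
  norm_num

/-- The distance none of whose blow-ups is self-similar or left-invariant. -/
noncomputable def dist₂ (p q : H) : ℝ := dbox p q + osc p q

lemma isDistance_dist₂ : IsDistance dist₂ := by
  refine ⟨fun p q => ?_, fun p => ?_, fun p q h => ?_, fun p q r => ?_⟩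
  · rw [dist₂, dist₂, dbox_comm, osc_comm]
  · have := osc_le p p
    rw [dbox_self] at this
    rw [dist₂, dbox_self]
    linarith [osc_nonneg p p]
  · rw [dist₂] at h
    exact eq_of_dbox_eq_zero (by linarith [osc_nonneg p q, dbox_nonneg p q])
  · unfold dist₂
    linarith [dbox_triangle p q r, osc_triangle p q r]

lemma dist₂_le (p q : H) : dist₂ p q ≤ 4 * dbox p q := by
  unfold dist₂
  linarith [osc_le p q]

/-- The distance `dist₂` seen at scale `lam` from the point `g`. -/
noncomputable def rescaled (lam : ℝ) (g p q : H) : ℝ :=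
  (1 / lam) * dist₂ (Hmul g (dil lam p)) (Hmul g (dil lam q))

lemma rescaled_le {lam : ℝ} (h : 0 < lam) (g p q : H) : rescaled lam g p q ≤ 4 * dbox p q := by
  have := dist₂_le (Hmul g (dil lam p)) (Hmul g (dil lam q))
  rw [dbox_Hmul_left, dbox_dil h] at this
  rw [rescaled, one_div, inv_mul_le_iff₀ h]
  linarith

lemma rescaled_comm (lam : ℝ) (g p q : H) : rescaled lam g p q = rescaled lam g q p := by
  rw [rescaled, rescaled, isDistance_dist₂.1]

lemma rescaled_triangle {lam : ℝ} (h : 0 < lam) (g p q r : H) :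
    rescaled lam g p r ≤ rescaled lam g p q + rescaled lam g q r := by
  rw [rescaled, rescaled, rescaled, ← mul_add]
  exact mul_le_mul_of_nonneg_left (isDistance_dist₂.2.2.2 _ _ _) (by positivity)

lemma rescaled_vert {lam mu : ℝ} (hl : 0 < lam) (hm : 0 < mu) (g p : H) :
    rescaled lam g p (vert (Real.pi * mu ^ 2) p) = Real.sqrt Real.pi * mu + (1 / lam) *
      osc (Hmul g (dil lam p)) (vert (Real.pi * (lam * mu) ^ 2) (Hmul g (dil lam p))) := by
  have e : lam ^ 2 * (Real.pi * mu ^ 2) = Real.pi * (lam * mu) ^ 2 := by ring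
  rw [rescaled, dil_vert, Hmul_vert, e, dist₂, dbox_vert (by positivity),
    Real.sqrt_mul Real.pi_pos.le, Real.sqrt_sq (by positivity)]
  field_simp

lemma exists_scale_near (K : ℕ) {lam : ℝ} (h0 : 0 < lam) (h1 : lam ≤ 1) :
    ∃ N, ∀ n, N ≤ n → n ≤ N + K → scale (K + 1) * lam ≤ scale n ∧ scale n ≤ lam := by
  obtain ⟨N, hN1, hN2⟩ := exists_nat_pow_near_of_lt_one h0 h1
    (by norm_num : (0 : ℝ) < 1 / 256) (by norm_num)
  refine ⟨N + 1, fun n hn hn' => ⟨?_, ?_⟩⟩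
  · calc scale (K + 1) * lam ≤ scale (K + 1) * (1 / 256) ^ N :=
          mul_le_mul_of_nonneg_left hN2 (scale_pos _).le
      _ = scale (N + 1 + K) := by unfold scale; ring
      _ ≤ scale n := pow_le_pow_of_le_one (by norm_num) (by norm_num) hn'
  · exact (pow_le_pow_of_le_one (by norm_num) (by norm_num) hn).trans hN1.le

lemma mem_closedBall_seven {a b : ℝ} (ha : |a| ≤ 7) (hb : |b| ≤ 7) :
    ((a, 0, b) : H) ∈ Metric.closedBall (0 : H) 7 := by
  simp [Prod.norm_def, ha, hb]

lemma abs_mul_floor_sub_le {mu : ℝ} (h0 : 0 < mu) (h1 : mu ≤ 1) (x : ℝ) {e : ℝ}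
    (he0 : 0 ≤ e) (he1 : e ≤ 1) : |mu * (⌊x⌋ + e - x)| ≤ 7 := by
  have f0 := Int.floor_le x
  have f1 := Int.lt_floor_add_one x
  rw [abs_mul, abs_of_pos h0]
  have : |⌊x⌋ + e - x| ≤ 1 := by rw [abs_le]; constructor <;> linarith
  calc _ ≤ 1 * 1 := mul_le_mul h1 this (abs_nonneg _) zero_le_one
    _ ≤ 7 := by norm_num

lemma exists_rescaled_vert_ge {lam mu : ℝ} (hl : 0 < lam) (h0 : 0 < mu) (h1 : mu ≤ 1) {n : ℕ}
    (hn : OddVal n) (hs : scale n = lam * mu) (g : H) : ∃ p ∈ Metric.closedBall (0 : H) 7,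
      (Real.sqrt Real.pi + 1) * mu ≤ rescaled lam g p (vert (Real.pi * mu ^ 2) p) := by
  set x := (scale n)⁻¹ * g.1 with hx
  set a := mu * (⌊x⌋ + 1 / 2 - x) with ha
  set A := phase (dil (scale n)⁻¹ (Hmul g (dil lam (a, 0, 0)))) with hA
  set k := ⌈A / (2 * Real.pi)⌉
  set b := mu ^ 2 * (k * (2 * Real.pi) - A) with hb
  have hpi := Real.pi_pos
  refine ⟨(a, 0, b), mem_closedBall_seven (abs_mul_floor_sub_le h0 h1 _ (by norm_num)
    (by norm_num)) ?_, ?_⟩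
  · have c0 : A ≤ k * (2 * Real.pi) := (div_le_iff₀ (by positivity)).1 (Int.le_ceil _)
    have c1 : (k - 1) * (2 * Real.pi) < A :=
      (lt_div_iff₀ (by positivity)).1 (by linarith [Int.ceil_lt_add_one (A / (2 * Real.pi))])
    have hmu2 : mu ^ 2 ≤ 1 := pow_le_one₀ h0.le h1
    have c2 : |k * (2 * Real.pi) - A| ≤ 7 := by
      rw [abs_le]; constructor <;> linarith [Real.pi_lt_d2]
    rw [hb, abs_mul, abs_of_nonneg (by positivity : 0 ≤ mu ^ 2)]
    calc _ ≤ 1 * 7 := mul_le_mul hmu2 c2 (abs_nonneg _) zero_le_one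
      _ = 7 := by norm_num
  · rw [rescaled_vert hl h0, ← hs]
    have hfst : (scale n)⁻¹ * (Hmul g (dil lam (a, 0, b))).1 = ⌊x⌋ + 1 / 2 := by
      have : (scale n)⁻¹ * (Hmul g (dil lam (a, 0, b))).1 = x + a / mu := by
        rw [hx, hs]
        simp only [Hmul, dil]
        field_simp
      rw [this, ha]
      field_simp
      ring
    have hbig : scale n ≤ osc (Hmul g (dil lam (a, 0, b)))
        (vert (Real.pi * scale n ^ 2) (Hmul g (dil lam (a, 0, b)))) := by
      refine scale_le_osc_vert hn ?_ ?_
      · rw [hfst]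
        have : Int.fract ((⌊x⌋ : ℝ) + 1 / 2) = 1 / 2 := by
          rw [Int.fract_intCast_add, Int.fract_eq_self]
          norm_num
        rw [tent, this]
        norm_num
      · have hvert : ((a, 0, b) : H) = vert b (a, 0, 0) := by simp [vert]
        have hph (t : ℝ) (p : H) : phase (vert t p) = phase p + t := by
          simp only [phase, vert]
          ring
        rw [hvert, dil_vert, Hmul_vert, dil_vert, hph, ← hA]
        have : A + (scale n)⁻¹ ^ 2 * (lam ^ 2 * b) = k * (2 * Real.pi) := by
          rw [hb, hs]
          field_simp
          ring
        rw [this, Real.cos_int_mul_two_pi]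
    have : mu ≤ 1 / lam * osc (Hmul g (dil lam (a, 0, b)))
        (vert (Real.pi * scale n ^ 2) (Hmul g (dil lam (a, 0, b)))) := by
      rw [one_div, le_inv_mul_iff₀ hl, ← hs]
      exact hbig
    linarith

lemma rescaled_vert_le {lam mu : ℝ} (hl : 0 < lam) (h0 : 0 < mu) (g p : H)
    (h : ∀ m, OddVal m → (4 * scale m ≤ lam * mu ∨ 4 * (lam * mu) ≤ scale m) ∨
      tent ((scale m)⁻¹ * (Hmul g (dil lam p)).1) = 0) :
    rescaled lam g p (vert (Real.pi * mu ^ 2) p) ≤ (Real.sqrt Real.pi + 1 / 2) * mu := by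
  have := osc_vert_le (mul_pos hl h0) _ h
  rw [rescaled_vert hl h0, add_mul]
  refine add_le_add le_rfl ?_
  rw [one_div, inv_mul_le_iff₀ hl]
  linarith

lemma exists_rescaled_vert_le {lam mu : ℝ} (hl : 0 < lam) (h0 : 0 < mu) (h1 : mu ≤ 1) {n : ℕ}
    (hs : scale n = lam * mu) (g : H) : ∃ p ∈ Metric.closedBall (0 : H) 7,
      rescaled lam g p (vert (Real.pi * mu ^ 2) p) ≤ (Real.sqrt Real.pi + 1 / 2) * mu := by
  set x := (scale n)⁻¹ * g.1 with hx
  set a := mu * (⌊x⌋ + 0 - x) with ha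
  refine ⟨(a, 0, 0), mem_closedBall_seven (abs_mul_floor_sub_le h0 h1 _ le_rfl zero_le_one)
    (by norm_num), rescaled_vert_le hl h0 g _ fun m _ => ?_⟩
  by_cases hmn : m = n
  · right
    have : (scale n)⁻¹ * (Hmul g (dil lam (a, 0, 0))).1 = x + a / mu := by
      rw [hx, hs]
      simp only [Hmul, dil]
      field_simp
    have e : (scale n)⁻¹ * (Hmul g (dil lam (a, 0, 0))).1 = (⌊x⌋ : ℝ) := by
      rw [this, ha]
      field_simp
      ring
    rw [hmn, e, tent, Int.fract_intCast]
    norm_num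
  · left
    rw [← hs]
    exact scale_far_of_ne hmn

section BlowUp

open Filter Topology

variable {lam : ℕ → ℝ} {qs : ℕ → H} {ρ : H → H → ℝ}

lemma tendsto_rescaled (hlam : ∀ j, 0 < lam j)
    (hρ : ∀ p q, Tendsto (fun j => rescaled (lam j) (qs j) p q) atTop (𝓝 (ρ p q)))
    {ps rs : ℕ → H} {p r : H} (hp : Tendsto ps atTop (𝓝 p)) (hr : Tendsto rs atTop (𝓝 r)) :
    Tendsto (fun j => rescaled (lam j) (qs j) (ps j) (rs j)) atTop (𝓝 (ρ p r)) := by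
  have hd {us : ℕ → H} {u : H} (hu : Tendsto us atTop (𝓝 u)) :
      Tendsto (fun j => dbox (us j) u) atTop (𝓝 0) := by
    have := (continuous_dbox.tendsto (u, u)).comp (hu.prodMk_nhds tendsto_const_nhds)
    rwa [dbox_self] at this
  have hsum : Tendsto (fun j => 4 * dbox (ps j) p + 4 * dbox (rs j) r) atTop (𝓝 0) := by
    simpa using ((hd hp).const_mul 4).add ((hd hr).const_mul 4)
  have hdiff : Tendsto (fun j => rescaled (lam j) (qs j) (ps j) (rs j)
      - rescaled (lam j) (qs j) p r) atTop (𝓝 0) := by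
    refine squeeze_zero_norm (fun j => ?_) hsum
    rw [Real.norm_eq_abs, abs_le]
    have hl := hlam j
    have t1 := rescaled_triangle hl (qs j) (ps j) p (rs j)
    have t2 := rescaled_triangle hl (qs j) p r (rs j)
    have t3 := rescaled_triangle hl (qs j) p (ps j) r
    have t4 := rescaled_triangle hl (qs j) (ps j) (rs j) r
    have b1 := rescaled_le hl (qs j) (ps j) p
    have b2 := rescaled_le hl (qs j) (rs j) r
    rw [rescaled_comm _ _ p (ps j)] at t3
    rw [rescaled_comm _ _ r (rs j)] at t2
    constructor <;> linarith
  simpa using hdiff.add (hρ p r)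

/-- Comparisons of vertical pairs that hold in a compact set along the blow-up pass to the
limit. -/
lemma exists_vert_pair_of_eventually (hlam : ∀ j, 0 < lam j)
    (hρ : ∀ p q, Tendsto (fun j => rescaled (lam j) (qs j) p q) atTop (𝓝 (ρ p q)))
    {S : Set (ℝ × H × H)} (hS : IsCompact S) {G : ℝ × H × H → H} (hG : Continuous G) (k : ℝ)
    (h : ∀ᶠ j in atTop, ∃ x ∈ S,
      (Real.sqrt Real.pi + 1) * x.1 ≤
        rescaled (lam j) (qs j) x.2.1 (vert (Real.pi * x.1 ^ 2) x.2.1) ∧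
      rescaled (lam j) (qs j) (G x) (vert (Real.pi * (k * x.1) ^ 2) (G x)) ≤
        (Real.sqrt Real.pi + 1 / 2) * (k * x.1)) :
    ∃ x ∈ S, (Real.sqrt Real.pi + 1) * x.1 ≤ ρ x.2.1 (vert (Real.pi * x.1 ^ 2) x.2.1) ∧
      ρ (G x) (vert (Real.pi * (k * x.1) ^ 2) (G x)) ≤
        (Real.sqrt Real.pi + 1 / 2) * (k * x.1) := by
  obtain ⟨j₀, hj₀⟩ := eventually_atTop.1 h
  choose x hxS hx1 hx2 using fun j => hj₀ (j + j₀) (Nat.le_add_left _ _)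
  obtain ⟨y, hy, φ, hφ, hlim⟩ := hS.tendsto_subseq hxS
  have hφ' : Tendsto (fun j => φ j + j₀) atTop atTop :=
    (tendsto_add_atTop_nat j₀).comp hφ.tendsto_atTop
  have hsub (F F' : ℝ × H × H → H) (hF : Continuous F) (hF' : Continuous F') :
      Tendsto (fun j => rescaled (lam (φ j + j₀)) (qs (φ j + j₀)) (F (x (φ j))) (F' (x (φ j))))
        atTop (𝓝 (ρ (F y) (F' y))) :=
    tendsto_rescaled (lam := fun j => lam (φ j + j₀)) (qs := fun j => qs (φ j + j₀))
      (fun j => hlam _) (fun p q => (hρ p q).comp hφ') ((hF.tendsto y).comp hlim)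
      ((hF'.tendsto y).comp hlim)
  have hcont (f : ℝ × H × H → ℝ) (hf : Continuous f) :
      Tendsto (fun j => f (x (φ j))) atTop (𝓝 (f y)) := (hf.tendsto y).comp hlim
  refine ⟨y, hy, ?_, ?_⟩
  · exact le_of_tendsto_of_tendsto' (hcont (fun x => (Real.sqrt Real.pi + 1) * x.1) (by fun_prop))
      (hsub (fun x => x.2.1) (fun x => vert (Real.pi * x.1 ^ 2) x.2.1) (by fun_prop)
        (by unfold vert; fun_prop)) fun j => hx1 _
  · exact le_of_tendsto_of_tendsto' (hsub G (fun x => vert (Real.pi * (k * x.1) ^ 2) (G x)) hG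
      (by unfold vert; fun_prop))
      (hcont (fun x => (Real.sqrt Real.pi + 1 / 2) * (k * x.1)) (by fun_prop)) fun j => hx2 _

lemma isCompact_vert_pairs (c : ℝ) : IsCompact
    (Set.Icc c 1 ×ˢ (Metric.closedBall (0 : H) 7 ×ˢ Metric.closedBall (0 : H) 7)) :=
  isCompact_Icc.prod ((isCompact_closedBall _ _).prod (isCompact_closedBall _ _))

lemma not_selfSimilar (hlam : ∀ j, 0 < lam j) (hlim : Tendsto lam atTop (𝓝 0))
    (hρ : ∀ p q, Tendsto (fun j => rescaled (lam j) (qs j) p q) atTop (𝓝 (ρ p q))) {r : ℝ}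
    (hr : 1 < r) (hsim : ∀ p q : H, ρ (dil r p) (dil r q) = r * ρ p q) : False := by
  obtain ⟨k, K, hK⟩ := exists_scale_far hr
  have hrk : 0 < r ^ k := pow_pos (by linarith) k
  have hsimk (p q : H) : ρ (dil (r ^ k) p) (dil (r ^ k) q) = r ^ k * ρ p q := by
    have hdil (i : ℕ) (p : H) : dil (r ^ (i + 1)) p = dil r (dil (r ^ i) p) := by
      ext <;> simp only [dil] <;> ring
    clear hK hrk
    induction k with
    | zero => simp [dil]
    | succ i ih => rw [hdil, hdil, hsim, ih, pow_succ]; ring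
  obtain ⟨x, ⟨⟨hx, -⟩, -⟩, h1, h2⟩ := exists_vert_pair_of_eventually hlam hρ
    (isCompact_vert_pairs (scale (K + 1))) (G := fun x => dil (r ^ k) x.2.1)
    (by unfold dil; fun_prop) (r ^ k) (by
      filter_upwards [hlim.eventually_le_const zero_lt_one] with j hj
      have hl := hlam j
      obtain ⟨N, hN⟩ := exists_scale_near K hl hj
      obtain ⟨n, hn1, hn2, hn3, hfar⟩ := hK N
      obtain ⟨hs1, hs2⟩ := hN n hn1 hn2
      have hs : scale n = lam j * (scale n / lam j) := by field_simp
      have hmu : 0 < scale n / lam j := div_pos (scale_pos n) hl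
      have hmu1 : scale n / lam j ≤ 1 := (div_le_one hl).2 hs2
      obtain ⟨p, hp, hge⟩ := exists_rescaled_vert_ge hl hmu hmu1 hn3 hs (qs j)
      refine ⟨(scale n / lam j, p, 0), ⟨⟨(le_div_iff₀ hl).2 hs1, hmu1⟩, hp, by simp⟩, hge,
        rescaled_vert_le hl (by positivity) _ _ fun m hm => Or.inl ?_⟩
      have e : lam j * (r ^ k * (scale n / lam j)) = r ^ k * scale n := by field_simp
      simpa only [e] using hfar m hm)
  have hx0 : 0 < x.1 := (scale_pos _).trans_le hx
  have e : Real.pi * (r ^ k * x.1) ^ 2 = (r ^ k) ^ 2 * (Real.pi * x.1 ^ 2) := by ring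
  rw [e, ← dil_vert, hsimk] at h2
  have := mul_le_mul_of_nonneg_left h1 hrk.le
  nlinarith [mul_pos hrk hx0]

lemma not_leftInvariant (hlam : ∀ j, 0 < lam j) (hlim : Tendsto lam atTop (𝓝 0))
    (hρ : ∀ p q, Tendsto (fun j => rescaled (lam j) (qs j) p q) atTop (𝓝 (ρ p q)))
    (hinv : ∀ g p q : H, ρ (Hmul g p) (Hmul g q) = ρ p q) : False := by
  obtain ⟨x, ⟨⟨hx, -⟩, -⟩, h1, h2⟩ := exists_vert_pair_of_eventually hlam hρ
    (isCompact_vert_pairs (scale (6 + 1))) (G := fun x => x.2.2) (by fun_prop) 1 (by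
      filter_upwards [hlim.eventually_le_const zero_lt_one] with j hj
      have hl := hlam j
      obtain ⟨N, hN⟩ := exists_scale_near 6 hl hj
      obtain ⟨n, hn1, hn2, hn3⟩ := exists_oddVal_near N
      obtain ⟨hs1, hs2⟩ := hN n hn1 hn2
      have hs : scale n = lam j * (scale n / lam j) := by field_simp
      have hmu : 0 < scale n / lam j := div_pos (scale_pos n) hl
      have hmu1 : scale n / lam j ≤ 1 := (div_le_one hl).2 hs2
      obtain ⟨p, hp, hge⟩ := exists_rescaled_vert_ge hl hmu hmu1 hn3 hs (qs j)
      obtain ⟨p', hp', hle⟩ := exists_rescaled_vert_le hl hmu hmu1 hs (qs j)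
      refine ⟨(scale n / lam j, p, p'), ⟨⟨(le_div_iff₀ hl).2 hs1, hmu1⟩, hp, hp'⟩, hge, ?_⟩
      simpa only [one_mul] using hle)
  have hx0 : 0 < x.1 := (scale_pos _).trans_le hx
  have e : x.2.2 = Hmul (Hmul x.2.2 (Hinv x.2.1)) x.2.1 := by
    ext <;> simp only [Hmul, Hinv] <;> ring
  simp only [one_mul] at h2
  rw [e, ← Hmul_vert, hinv] at h2
  linarith

end BlowUp

/-- Theorem 1.5 (2). There exists a distance `d₂` on `ℍ`, biLipschitz
equivalent to `d_b`, no blow-up of which is self-similar or left-invariant. -/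
theorem statement5 :
    ∃ d₂ : H → H → ℝ, IsDistance d₂ ∧
      (∃ C : ℝ, 1 ≤ C ∧ ∀ p q : H, C⁻¹ * dbox p q ≤ d₂ p q ∧ d₂ p q ≤ C * dbox p q) ∧
      ∀ (lam : ℕ → ℝ) (qs : ℕ → H) (ρ : H → H → ℝ),
        (∀ j, 0 < lam j) →
        Filter.Tendsto lam Filter.atTop (nhds 0) →
        (∀ p₁ p₂ : H, Filter.Tendsto
          (fun j => (1 / lam j) *
            d₂ (Hmul (qs j) (dil (lam j) p₁)) (Hmul (qs j) (dil (lam j) p₂)))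
          Filter.atTop (nhds (ρ p₁ p₂))) →
        (¬ ∃ lam' : ℝ, 1 < lam' ∧
            ∀ p q : H, ρ (dil lam' p) (dil lam' q) = lam' * ρ p q) ∧
        ¬ (∀ g p q : H, ρ (Hmul g p) (Hmul g q) = ρ p q) := by
  refine ⟨dist₂, isDistance_dist₂, ⟨4, by norm_num, fun p q => ⟨?_, dist₂_le p q⟩⟩,
    fun lam qs ρ hlam hlim hρ => ⟨?_, not_leftInvariant hlam hlim hρ⟩⟩
  · rw [dist₂]
    linarith [osc_nonneg p q, dbox_nonneg p q]
  · rintro ⟨r, hr, hsim⟩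
    exact not_selfSimilar hlam hlim hρ hr hsim

end Heis
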